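/- For every η = (η₀, η⃗) ∈ ℝ⁴ with η₀ > |η⃗| (i.e. η in the open forward light cone Γ₊) and every Schwartz function g on ℝ⁴, the limit as t → 0⁺ of ∫_{ℝ⁴} f(x − i t η) g(x) dx exists and equals Δ₊(g) := (2π)^{−3} ∫_{ℝ³} (1/(2ω(k))) · ( ∫_{ℝ⁴} g(x₀, x⃗) e^{−i ω(k) x₀ + i⟨k, x⃗⟩} dx₀ dx⃗ ) dk. In other words, the two-point function Δ₊ is the boundary value, in the sense of tempered distributions, of the analytic function f. -/

import Mathlib

open MeasureTheory

/-- The on-shell energy `ω(k) = √(|k|² + m²)` for `k ∈ ℝ³`. -/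
noncomputable def omega (m : ℝ) (k : Fin 3 → ℝ) : ℝ :=
  Real.sqrt ((∑ i, k i ^ 2) + m ^ 2)

/-- The open forward light cone `Γ₊ = {x ∈ ℝ⁴ : x₀ > |x⃗|}`, with `ℝ⁴ = ℝ × ℝ³`. -/
noncomputable def forwardCone : Set (ℝ × (Fin 3 → ℝ)) :=
  {x | Real.sqrt (∑ i, x.2 i ^ 2) < x.1}

/-- The analytic function `f(z) = (2π)⁻³ ∫_{ℝ³} e^{−iω(k)z₀ + i⟨k,z⃗⟩}/(2ω(k)) dk`
on the tube `{z ∈ ℂ⁴ : −Im z₀ > |Im z⃗|}`. -/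
noncomputable def fAna (m : ℝ) (z : ℂ × (Fin 3 → ℂ)) : ℂ :=
  ((((2 * Real.pi) ^ 3)⁻¹ : ℝ) : ℂ) *
    ∫ k : Fin 3 → ℝ,
      Complex.exp (-Complex.I * (omega m k : ℂ) * z.1 +
          Complex.I * ∑ i, (k i : ℂ) * z.2 i) /
        (2 * (omega m k : ℂ))

/-- The complex point `x − i t η ∈ ℂ⁴` for `x, η ∈ ℝ⁴`, `t ∈ ℝ`. -/
noncomputable def cpt (x η : ℝ × (Fin 3 → ℝ)) (t : ℝ) : ℂ × (Fin 3 → ℂ) :=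
  ((x.1 : ℂ) - Complex.I * (t : ℂ) * (η.1 : ℂ),
    fun i => (x.2 i : ℂ) - Complex.I * (t : ℂ) * (η.2 i : ℂ))

/-- The two-point function `Δ₊` of the free scalar field of mass `m`, as a functional:
`Δ₊(g) = (2π)⁻³ ∫_{ℝ³} (1/(2ω(k))) ∫_{ℝ⁴} g(x₀,x⃗) e^{−iω(k)x₀ + i⟨k,x⃗⟩} dx dk`. -/
noncomputable def twoPoint (m : ℝ) (g : (ℝ × (Fin 3 → ℝ)) → ℂ) : ℂ :=
  ((((2 * Real.pi) ^ 3)⁻¹ : ℝ) : ℂ) *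
    ∫ k : Fin 3 → ℝ, (((2 * omega m k)⁻¹ : ℝ) : ℂ) *
      ∫ x : ℝ × (Fin 3 → ℝ),
        g x * Complex.exp (-Complex.I * (omega m k : ℂ) * (x.1 : ℂ) +
          Complex.I * ∑ i, (k i : ℂ) * (x.2 i : ℂ))

open scoped FourierTransform

/-- Directional decay of the Fourier transform of a Schwartz function: for a fixed vector `v`, the
transform at a linear form `φ` decays faster than any power of `φ v`. -/
lemma SchwartzMap.exists_abs_pow_mul_norm_fourier_le {V : Type*} [NormedAddCommGroup V]
    [NormedSpace ℝ V] [FiniteDimensional ℝ V] [MeasurableSpace V] [BorelSpace V]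
    (μ : Measure V) [μ.IsAddHaarMeasure] (g : SchwartzMap V ℂ) (v : V) (n : ℕ) :
    ∃ C : ℝ, ∀ φ : V →L[ℝ] ℝ, |φ v| ^ n * ‖∫ x, 𝐞 (-φ x) • g x ∂μ‖ ≤ C := by
  have h (φ : V →L[ℝ] ℝ) := VectorFourier.pow_mul_norm_iteratedFDeriv_fourierIntegral_le
    (ContinuousLinearMap.apply ℝ ℝ : V →L[ℝ] (V →L[ℝ] ℝ) →L[ℝ] ℝ) (f := g) (μ := μ)
    (K := ⊤) (N := ⊤) (g.smooth ⊤)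
    (fun k n _ _ => g.integrable_pow_mul_iteratedFDeriv μ k n) (k := 0) (n := n) le_top le_top v φ
  simp only [norm_iteratedFDeriv_zero] at h
  exact ⟨_, h⟩

lemma omega_pos {m : ℝ} (hm : 0 < m) (k : Fin 3 → ℝ) : 0 < omega m k := by
  have : 0 ≤ ∑ i, k i ^ 2 := Finset.sum_nonneg fun i _ => sq_nonneg _
  exact Real.sqrt_pos.2 (by positivity)

lemma mass_le_omega (m : ℝ) (k : Fin 3 → ℝ) : m ≤ omega m k :=
  Real.le_sqrt_of_sq_le (le_add_of_nonneg_left (Finset.sum_nonneg fun _ _ => sq_nonneg _))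

lemma norm_le_omega (m : ℝ) (k : Fin 3 → ℝ) : ‖k‖ ≤ omega m k := by
  refine (pi_norm_le_iff_of_nonneg (Real.sqrt_nonneg _)).2 fun i => Real.le_sqrt_of_sq_le ?_
  have := Finset.single_le_sum (f := fun i => k i ^ 2) (fun i _ => sq_nonneg _) (Finset.mem_univ i)
  rw [Real.norm_eq_abs, sq_abs]
  nlinarith [sq_nonneg m]

@[fun_prop]
lemma continuous_omega (m : ℝ) : Continuous (omega m) := by
  unfold omega
  fun_prop

lemma integrable_inv_omega_pow {m : ℝ} (hm : 0 < m) :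
    Integrable (fun k : Fin 3 → ℝ => (omega m k ^ 4)⁻¹) := by
  have hI : Integrable (fun k : Fin 3 → ℝ => (1 + ‖k‖) ^ (-(4 : ℝ))) :=
    integrable_one_add_norm (by simp; norm_num)
  refine (hI.const_mul ((m⁻¹ + 1) ^ 4)).mono' ?_ (.of_forall fun k => ?_)
  · exact (Continuous.inv₀ (by fun_prop)
      fun k => (pow_pos (omega_pos hm k) 4).ne').aestronglyMeasurable
  · have hω := omega_pos hm k
    rw [Real.norm_of_nonneg (by positivity), Real.rpow_neg (by positivity),
      show (4 : ℝ) = (4 : ℕ) by norm_num, Real.rpow_natCast, ← div_eq_mul_inv, inv_le_comm₀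
      (by positivity) (by positivity), inv_div, ← div_pow]
    gcongr
    rw [div_le_iff₀ (by positivity)]
    have h1 : 1 ≤ omega m k * m⁻¹ := by
      rw [← div_eq_mul_inv, one_le_div hm]; exact mass_le_omega m k
    linarith [norm_le_omega m k]

/-- The Minkowski product of `η` with the mass-shell momentum `(ω(k), k)` is bounded below by a
multiple of `ω(k)` when `η` lies in the forward cone. -/
lemma exists_mul_omega_le {m : ℝ} {η : ℝ × (Fin 3 → ℝ)} (hη : η ∈ forwardCone) :
    ∃ c > 0, ∀ k, c * omega m k ≤ omega m k * η.1 - ∑ i, k i * η.2 i := by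
  refine ⟨η.1 - √(∑ i, η.2 i ^ 2), sub_pos.2 hη, fun k => ?_⟩
  have h1 : √(∑ i, k i ^ 2) ≤ omega m k := Real.sqrt_le_sqrt (by nlinarith [sq_nonneg m])
  have h2 := Real.sum_mul_le_sqrt_mul_sqrt Finset.univ k η.2
  nlinarith [mul_le_mul_of_nonneg_right h1 (Real.sqrt_nonneg (∑ i, η.2 i ^ 2))]

/-- The integrand `e^{−iω(k)x₀ + i⟨k,x⃗⟩}` of the plane-wave expansion. -/
noncomputable def planeWave (m : ℝ) (k : Fin 3 → ℝ) (x : ℝ × (Fin 3 → ℝ)) : ℂ :=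
  Complex.exp (-Complex.I * (omega m k : ℂ) * (x.1 : ℂ) +
    Complex.I * ∑ i, (k i : ℂ) * (x.2 i : ℂ))

lemma planeWave_eq (m : ℝ) (k : Fin 3 → ℝ) (x : ℝ × (Fin 3 → ℝ)) :
    planeWave m k x =
      Complex.exp (((∑ i, k i * x.2 i - omega m k * x.1 : ℝ) : ℂ) * Complex.I) := by
  unfold planeWave
  push_cast
  ring_nf

lemma norm_planeWave (m : ℝ) (k : Fin 3 → ℝ) (x : ℝ × (Fin 3 → ℝ)) : ‖planeWave m k x‖ = 1 := by
  rw [planeWave_eq, Complex.norm_exp_ofReal_mul_I]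

lemma continuous_planeWave (m : ℝ) :
    Continuous fun p : (Fin 3 → ℝ) × (ℝ × (Fin 3 → ℝ)) => planeWave m p.1 p.2 := by
  unfold planeWave
  fun_prop

lemma exp_cpt_eq (m : ℝ) (k : Fin 3 → ℝ) (x η : ℝ × (Fin 3 → ℝ)) (t : ℝ) :
    Complex.exp (-Complex.I * (omega m k : ℂ) * (cpt x η t).1 +
        Complex.I * ∑ i, (k i : ℂ) * (cpt x η t).2 i) =
      (Real.exp (-(t * (omega m k * η.1 - ∑ i, k i * η.2 i))) : ℂ) * planeWave m k x := by
  rw [planeWave, Complex.ofReal_exp, ← Complex.exp_add]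
  congr 1
  have h : ∀ i, (k i : ℂ) * (cpt x η t).2 i =
      k i * x.2 i - Complex.I * t * (k i * η.2 i) := fun i => by simp only [cpt]; ring
  simp only [h, Finset.sum_sub_distrib, ← Finset.mul_sum]
  simp only [cpt]
  push_cast
  linear_combination (t * (omega m k * η.1 - ∑ i, (k i : ℂ) * η.2 i)) * Complex.I_sq

/-- The Fourier transform of `g` restricted to the mass shell. -/
noncomputable def onShell (m : ℝ) (g : ℝ × (Fin 3 → ℝ) → ℂ) (k : Fin 3 → ℝ) : ℂ :=
  ∫ x, g x * planeWave m k x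

lemma stronglyMeasurable_onShell (m : ℝ) {g : ℝ × (Fin 3 → ℝ) → ℂ} (hg : Continuous g) :
    StronglyMeasurable (onShell m g) :=
  StronglyMeasurable.integral_prod_right'
    (f := fun p : (Fin 3 → ℝ) × (ℝ × (Fin 3 → ℝ)) => g p.2 * planeWave m p.1 p.2)
    ((hg.comp continuous_snd).mul (continuous_planeWave m)).stronglyMeasurable

lemma exists_norm_onShell_le {m : ℝ} (hm : 0 < m) (g : SchwartzMap (ℝ × (Fin 3 → ℝ)) ℂ) :
    ∃ C : ℝ, ∀ k, ‖onShell m g k‖ ≤ C * (omega m k ^ 4)⁻¹ := by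
  have : (volume : Measure (ℝ × (Fin 3 → ℝ))).IsAddHaarMeasure :=
    Measure.prod.instIsAddHaarMeasure _ _
  obtain ⟨C, hC⟩ := g.exists_abs_pow_mul_norm_fourier_le volume (1, 0) 4
  refine ⟨(2 * Real.pi) ^ 4 * C, fun k => ?_⟩
  have hω := omega_pos hm k
  let φ : ℝ × (Fin 3 → ℝ) →L[ℝ] ℝ := (2 * Real.pi)⁻¹ •
    (omega m k • ContinuousLinearMap.fst ℝ ℝ (Fin 3 → ℝ) -
      ∑ i, k i • (ContinuousLinearMap.proj i).comp (ContinuousLinearMap.snd ℝ ℝ (Fin 3 → ℝ)))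
  have hφ : ∀ x, φ x = (2 * Real.pi)⁻¹ * (omega m k * x.1 - ∑ i, k i * x.2 i) := fun x => by
    simp [φ]
  have hI : ∫ x, 𝐞 (-φ x) • g x = onShell m g k := by
    refine integral_congr_ae (.of_forall fun x => ?_)
    simp only [Circle.smul_def, smul_eq_mul, Real.fourierChar_apply, planeWave_eq, hφ]
    rw [mul_comm]
    congr 4
    field_simp
    ring
  have h := hC φ
  rw [hI, hφ] at h
  simp only [Pi.zero_apply, mul_zero, Finset.sum_const_zero, mul_one, sub_zero] at h
  rw [abs_of_pos (by positivity), mul_pow] at h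
  rw [← div_eq_mul_inv, le_div_iff₀ (by positivity)]
  calc ‖onShell m g k‖ * omega m k ^ 4
      = (2 * Real.pi) ^ 4 * ((2 * Real.pi)⁻¹ ^ 4 * omega m k ^ 4 * ‖onShell m g k‖) := by
        field_simp
    _ ≤ _ := by gcongr

lemma integrable_exp_neg_div_omega {m : ℝ} (hm : 0 < m) {η : ℝ × (Fin 3 → ℝ)}
    (hη : η ∈ forwardCone) {t : ℝ} (ht : 0 < t) :
    Integrable fun k : Fin 3 → ℝ =>
      Real.exp (-(t * (omega m k * η.1 - ∑ i, k i * η.2 i))) * (2 * omega m k)⁻¹ := by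
  obtain ⟨c, hc, hcω⟩ := exists_mul_omega_le (m := m) hη
  have hcont : Continuous fun k : Fin 3 → ℝ =>
      Real.exp (-(t * (omega m k * η.1 - ∑ i, k i * η.2 i))) * (2 * omega m k)⁻¹ := by
    refine Continuous.mul (by fun_prop) (Continuous.inv₀ (by fun_prop) fun k => ?_)
    exact (mul_pos two_pos (omega_pos hm k)).ne'
  refine ((integrable_inv_omega_pow hm).const_mul (24 / (t * c) ^ 4 * (2 * m)⁻¹)).mono'
    hcont.aestronglyMeasurable (.of_forall fun k => ?_)
  have hω := omega_pos hm k
  have hexp : Real.exp (-(t * (omega m k * η.1 - ∑ i, k i * η.2 i))) ≤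
      24 / (t * c) ^ 4 * (omega m k ^ 4)⁻¹ := by
    rw [Real.exp_neg, inv_le_comm₀ (Real.exp_pos _) (by positivity)]
    have h := Real.pow_div_factorial_le_exp (x := t * c * omega m k) (by positivity) 4
    calc _ = (t * c * omega m k) ^ 4 / (Nat.factorial 4 : ℕ) := by
          rw [show (Nat.factorial 4 : ℕ) = 24 from rfl]; push_cast; field_simp
      _ ≤ _ := h
      _ ≤ _ := by
        refine Real.exp_le_exp.2 ?_
        rw [mul_assoc]
        exact mul_le_mul_of_nonneg_left (hcω k) ht.le
  rw [Real.norm_of_nonneg (by positivity), mul_right_comm]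
  gcongr
  exact mass_le_omega m k

lemma integral_fAna_mul_eq {m : ℝ} (hm : 0 < m) {η : ℝ × (Fin 3 → ℝ)} (hη : η ∈ forwardCone)
    {g : ℝ × (Fin 3 → ℝ) → ℂ} (hg : Integrable g) {t : ℝ} (ht : 0 < t) :
    ∫ x, fAna m (cpt x η t) * g x = ((((2 * Real.pi) ^ 3)⁻¹ : ℝ) : ℂ) *
      ∫ k : Fin 3 → ℝ, ((Real.exp (-(t * (omega m k * η.1 - ∑ i, k i * η.2 i))) *
        (2 * omega m k)⁻¹ : ℝ) : ℂ) * onShell m g k := by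
  set A : (Fin 3 → ℝ) → ℂ := fun k =>
    ((Real.exp (-(t * (omega m k * η.1 - ∑ i, k i * η.2 i))) * (2 * omega m k)⁻¹ : ℝ) : ℂ) with hA
  have hAint : Integrable A := (integrable_exp_neg_div_omega hm hη ht).ofReal
  have hf : ∀ x, fAna m (cpt x η t) * g x = ((((2 * Real.pi) ^ 3)⁻¹ : ℝ) : ℂ) *
      ∫ k, A k * g x * planeWave m k x := fun x => by
    rw [fAna, mul_assoc, ← integral_mul_const]
    congr 2 with k
    rw [exp_cpt_eq, hA]
    push_cast
    ring
  have hprod : Integrable (Function.uncurry fun (x : ℝ × (Fin 3 → ℝ)) k =>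
      A k * g x * planeWave m k x) (volume.prod volume) := by
    refine ((hg.mul_prod hAint).bdd_mul (c := 1)
      (f := fun p : (ℝ × (Fin 3 → ℝ)) × (Fin 3 → ℝ) => planeWave m p.2 p.1)
      ((continuous_planeWave m).comp continuous_swap).aestronglyMeasurable
      (.of_forall fun p => (norm_planeWave m _ _).le)).congr (.of_forall fun p => ?_)
    simp only [Function.uncurry]
    ring
  simp_rw [hf]
  rw [integral_const_mul, integral_integral_swap hprod]
  simp_rw [mul_assoc, integral_const_mul, hA, onShell]

/-- `Δ₊` is the boundary value of the analytic function `f` in the sense of tempered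
distributions: for every `η` in the open forward light cone and every Schwartz function `g`,
`∫ f(x − itη) g(x) dx → Δ₊(g)` as `t → 0⁺`. -/
theorem twoPoint_boundary_value (m : ℝ) (hm : 0 < m)
    (η : ℝ × (Fin 3 → ℝ)) (hη : η ∈ forwardCone)
    (g : SchwartzMap (ℝ × (Fin 3 → ℝ)) ℂ) :
    Filter.Tendsto (fun t : ℝ => ∫ x : ℝ × (Fin 3 → ℝ), fAna m (cpt x η t) * g x)
      (nhdsWithin 0 (Set.Ioi 0)) (nhds (twoPoint m g)) := by
  have : (volume : Measure (ℝ × (Fin 3 → ℝ))).IsAddHaarMeasure :=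
    Measure.prod.instIsAddHaarMeasure _ _
  obtain ⟨C, hC⟩ := exists_norm_onShell_le hm g
  obtain ⟨c, hc, hcω⟩ := exists_mul_omega_le (m := m) hη
  have hmem : ∀ᶠ t : ℝ in nhdsWithin 0 (Set.Ioi 0), 0 < t := self_mem_nhdsWithin
  refine Filter.Tendsto.congr' (hmem.mono fun t ht =>
    (integral_fAna_mul_eq hm hη g.integrable ht).symm) (Filter.Tendsto.const_mul _ ?_)
  refine tendsto_integral_filter_of_dominated_convergence
    (fun k => (2 * m)⁻¹ * (C * (omega m k ^ 4)⁻¹)) (hmem.mono fun t ht => ?_)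
    (hmem.mono fun t ht => .of_forall fun k => ?_)
    (((integrable_inv_omega_pow hm).const_mul C).const_mul _) (.of_forall fun k => ?_)
  · exact (integrable_exp_neg_div_omega hm hη ht).ofReal.aestronglyMeasurable.mul
      (stronglyMeasurable_onShell m g.continuous).aestronglyMeasurable
  · have hω := omega_pos hm k
    rw [norm_mul, Complex.norm_real, Real.norm_of_nonneg (by positivity)]
    have hexp : Real.exp (-(t * (omega m k * η.1 - ∑ i, k i * η.2 i))) ≤ 1 := by
      rw [Real.exp_le_one_iff, neg_nonpos]
      exact mul_nonneg ht.le ((mul_pos hc hω).le.trans (hcω k))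
    have hinv : (2 * omega m k)⁻¹ ≤ (2 * m)⁻¹ := by
      gcongr
      exact mass_le_omega m k
    refine mul_le_mul ?_ (hC k) (norm_nonneg _) (by positivity)
    calc _ ≤ 1 * (2 * m)⁻¹ := mul_le_mul hexp hinv (by positivity) zero_le_one
      _ = _ := one_mul _
  · have hcont : Continuous fun t : ℝ =>
        ((Real.exp (-(t * (omega m k * η.1 - ∑ i, k i * η.2 i))) *
          (2 * omega m k)⁻¹ : ℝ) : ℂ) * onShell m g k := by fun_prop
    have h := (hcont.tendsto 0).mono_left (nhdsWithin_le_nhds (s := Set.Ioi 0))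
    simp only [zero_mul, neg_zero, Real.exp_zero, one_mul] at h
    exact h
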